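/- arXiv:2412.19082 — 2 statements merged into one kernel-verified Lean document; each statement's English description precedes it below -/
import Mathlib

section
/- Let T > 0 and let A, b, Q, Γ, Q_T ∈ ℝ with Q ≥ 0 and Q_T ≥ 0. There exists a constant C ≥ 0 (depending only on A, b, Q, Γ, Q_T, T) such that: for every λ ∈ [−1,1], if Π̄^λ : [0,T] → ℝ is differentiable and satisfies Π̄^λ′(t) + (2A + 2bλ) Π̄^λ(t) − c (Π̄^λ(t))² + (Q/2)(1 − Γλ)² = 0 on [0,T] with Π̄^λ(T) = Q_T/2, where c ≥ 0 is a fixed constant, then 0 ≤ Π̄^λ(t) ≤ C for all t ∈ [0,T]. -/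
/-- Uniform boundedness over `λ ∈ [−1,1]` of the solutions of the scalar backward Riccati
equations `Π̄' + (2A + 2bλ)Π̄ − cΠ̄² + (Q/2)(1 − Γλ)² = 0`, `Π̄(T) = Q_T/2` (with `c ≥ 0`):
there is a constant `C ≥ 0` depending only on `A, b, Q, Γ, Q_T, T` such that
`0 ≤ Π̄(t) ≤ C` on `[0,T]`. -/
theorem stmt9 (T A b Q Γ QT : ℝ) (hT : 0 < T) (hQ : 0 ≤ Q) (hQT : 0 ≤ QT) :
    ∃ C : ℝ, 0 ≤ C ∧
      ∀ (c : ℝ), 0 ≤ c →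
      ∀ lam ∈ Set.Icc (-1 : ℝ) 1,
      ∀ PiBar : ℝ → ℝ,
        (∀ t ∈ Set.Icc (0 : ℝ) T,
          HasDerivWithinAt PiBar
            (-((2 * A + 2 * b * lam) * PiBar t) + c * (PiBar t) ^ 2 - (Q / 2) * (1 - Γ * lam) ^ 2)
            (Set.Icc (0 : ℝ) T) t) →
        PiBar T = QT / 2 →
        ∀ t ∈ Set.Icc (0 : ℝ) T, 0 ≤ PiBar t ∧ PiBar t ≤ C := by
  set K : ℝ := 2 * |A| + 2 * |b| with hK
  set R : ℝ := (Q / 2) * (1 + |Γ|) ^ 2 with hR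
  have hK0 : 0 ≤ K := by positivity
  have hR0 : 0 ≤ R := by positivity
  refine ⟨Real.exp (K * T) * (QT / 2) + Real.exp (K * T) * R * T, by positivity, ?_⟩
  intro c hc lam hlam P hP hPT
  have hl : |lam| ≤ 1 := abs_le.2 hlam
  have hcont : ContinuousOn P (Set.Icc 0 T) := fun t ht => (hP t ht).continuousWithinAt
  set q : ℝ := (Q / 2) * (1 - Γ * lam) ^ 2 with hq
  have hq0 : 0 ≤ q := by positivity
  set a : ℝ := 2 * A + 2 * b * lam with ha
  have hbl : |b * lam| ≤ |b| := by
    rw [abs_mul]; nlinarith [abs_nonneg b]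
  have hGl : |Γ * lam| ≤ |Γ| := by
    rw [abs_mul]; nlinarith [abs_nonneg Γ]
  have haK : a ≤ K := by
    have h1 := le_abs_self A
    have h2 := le_abs_self (b * lam)
    rw [ha, hK]; linarith
  have hqR : q ≤ R := by
    have h1 := abs_le.1 hGl
    rw [hq, hR]
    refine mul_le_mul_of_nonneg_left ?_ (by positivity)
    exact sq_le_sq' (by linarith [abs_nonneg Γ]) (by linarith)
  have hpos : ∀ t ∈ Set.Icc (0 : ℝ) T, 0 ≤ P t := by
    intro t ht
    let g : ℝ → ℝ := fun s => a - c * Set.IccExtend hT.le ((Set.Icc 0 T).domRestrict P) s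
    have hg : Continuous g := by
      have : Continuous (Set.IccExtend hT.le ((Set.Icc 0 T).domRestrict P)) :=
        (continuousOn_iff_continuous_domRestrict.1 hcont).Icc_extend'
      exact continuous_const.sub (continuous_const.mul this)
    have hgP : ∀ s ∈ Set.Icc (0 : ℝ) T, g s = a - c * P s := by
      intro s hs
      simp only [g]
      rw [Set.IccExtend_of_mem hT.le _ hs]
      rfl
    let F : ℝ → ℝ := fun s => ∫ x in (0:ℝ)..s, g x
    have hF : ∀ s, HasDerivAt F (g s) s := fun s => hg.integral_hasStrictDerivAt 0 s |>.hasDerivAt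
    have hd : ∀ s ∈ Set.Icc (0 : ℝ) T, HasDerivWithinAt (fun s => Real.exp (F s) * P s)
        (-(Real.exp (F s) * q)) (Set.Icc 0 T) s := by
      intro s hs
      refine (((hF s).exp.hasDerivWithinAt).mul (hP s hs)).congr_deriv ?_
      rw [hgP s hs]; ring
    have hanti : AntitoneOn (fun s => Real.exp (F s) * P s) (Set.Icc 0 T) := by
      apply antitoneOn_of_hasDerivWithinAt_nonpos (convex_Icc 0 T)
        (fun s hs => (hd s hs).continuousWithinAt)
        (fun s hs => (hd s (interior_subset hs)).mono interior_subset)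
      intro s _
      have := mul_nonneg (Real.exp_pos (F s)).le hq0
      linarith
    have h := hanti ht (Set.right_mem_Icc.2 hT.le) ht.2
    simp only [hPT] at h
    have h2 : 0 ≤ Real.exp (F t) * P t := le_trans (by positivity) h
    exact nonneg_of_mul_nonneg_right h2 (Real.exp_pos _)
  intro t ht
  refine ⟨hpos t ht, ?_⟩
  have hd : ∀ s ∈ Set.Icc (0 : ℝ) T,
      HasDerivWithinAt (fun s => Real.exp (K * s) * P s + Real.exp (K * T) * R * s)
      (Real.exp (K * s) * ((K - a) * P s + c * P s ^ 2 - q) + Real.exp (K * T) * R)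
      (Set.Icc 0 T) s := by
    intro s hs
    have h1 : HasDerivAt (fun s => Real.exp (K * s)) (Real.exp (K * s) * (K * 1)) s :=
      ((hasDerivAt_id s).const_mul K).exp
    have h2 : HasDerivAt (fun s => Real.exp (K * T) * R * s) (Real.exp (K * T) * R * 1) s :=
      (hasDerivAt_id s).const_mul _
    refine ((h1.hasDerivWithinAt.mul (hP s hs)).add h2.hasDerivWithinAt).congr_deriv ?_
    ring
  have hmono : MonotoneOn (fun s => Real.exp (K * s) * P s + Real.exp (K * T) * R * s)
      (Set.Icc 0 T) := by
    apply monotoneOn_of_hasDerivWithinAt_nonneg (convex_Icc 0 T)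
      (fun s hs => (hd s hs).continuousWithinAt)
      (fun s hs => (hd s (interior_subset hs)).mono interior_subset)
    intro s hs
    have hs' := interior_subset hs
    have h1 : 0 ≤ (K - a) * P s := mul_nonneg (by linarith) (hpos s hs')
    have h2 : 0 ≤ c * P s ^ 2 := by positivity
    have h3 : Real.exp (K * s) ≤ Real.exp (K * T) :=
      Real.exp_le_exp.2 (mul_le_mul_of_nonneg_left hs'.2 hK0)
    have h4 : Real.exp (K * s) * q ≤ Real.exp (K * T) * R :=
      mul_le_mul h3 hqR hq0 (Real.exp_pos _).le
    have h5 : 0 ≤ Real.exp (K * s) * ((K - a) * P s + c * P s ^ 2) :=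
      mul_nonneg (Real.exp_pos _).le (by linarith)
    linarith
  have h := hmono ht (Set.right_mem_Icc.2 hT.le) ht.2
  simp only [hPT] at h
  have h1 : 1 ≤ Real.exp (K * t) := Real.one_le_exp (mul_nonneg hK0 ht.1)
  have h2 : P t ≤ Real.exp (K * t) * P t := le_mul_of_one_le_left (hpos t ht) h1
  have h3 : 0 ≤ Real.exp (K * T) * R * t := mul_nonneg (by positivity) ht.1
  linarith
end

section
/- (Decomposition of the operator-valued Riccati equation.) Let H be a real separable Hilbert space, let {f_l}_{l∈ℕ} be an orthonormal family in H, let (λ_l)_{l∈ℕ} ⊂ [−1,1], and let M : H → H be the bounded self-adjoint operator M v = ∑_l λ_l ⟨f_l, v⟩ f_l. Let T > 0 and A, b, B, Γ ∈ ℝ, R > 0, Q ≥ 0, Q_T ≥ 0. For each l, let Π̄^l : [0,T] → ℝ be differentiable with (d/dt)Π̄^l(t) + (2A + 2bλ_l)Π̄^l(t) − (2B²/R)(Π̄^l(t))² + (Q/2)(1 − Γλ_l)² = 0 and Π̄^l(T) = Q_T/2, and let Π^⊥ : [0,T] → ℝ be differentiable with (d/dt)Π^⊥(t) + 2AΠ^⊥(t)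 − (2B²/R)(Π^⊥(t))² + Q/2 = 0 and Π^⊥(T) = Q_T/2; assume sup_{l} sup_{t∈[0,T]} |Π̄^l(t)| < ∞. Define, for t ∈ [0,T] and v ∈ H, Π_t v = Π^⊥(t) v + ∑_l (Π̄^l(t) − Π^⊥(t)) ⟨f_l, v⟩ f_l. Then for all t ∈ [0,T] and v ∈ H, Π_t v = (Q_T/2) v + ∫_t^T [ 2A·Π_s v + 2b·M(Π_s v) − (2B²/R)·Π_s(Π_s v) + (Q/2)( v − 2Γ M v + Γ² M(M v) ) ] ds, where the integral is a Bochner integral in H. -/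
open scoped RealInnerProductSpace
open intervalIntegral

/-- The compact self-adjoint operator `M v = ∑_l λ_l ⟨f_l, v⟩ f_l`. -/
noncomputable def Mop {H : Type*} [NormedAddCommGroup H] [InnerProductSpace ℝ H]
    (f : ℕ → H) (lam : ℕ → ℝ) : H → H :=
  fun v => ∑' l, (lam l * ⟪f l, v⟫) • f l

/-- The decomposed operator family `Π_t v = Π^⊥(t) v + ∑_l (Π̄^l(t) − Π^⊥(t))⟨f_l, v⟩ f_l`. -/
noncomputable def PiFam {H : Type*} [NormedAddCommGroup H] [InnerProductSpace ℝ H]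
    (f : ℕ → H) (PiBar : ℕ → ℝ → ℝ) (PiBot : ℝ → ℝ) (t : ℝ) : H → H :=
  fun v => PiBot t • v + ∑' l, ((PiBar l t - PiBot t) * ⟪f l, v⟫) • f l

section helpers

variable {H : Type*} [NormedAddCommGroup H] [InnerProductSpace ℝ H]

lemma aux_finite_bound {f : ℕ → H} (hf : Orthonormal ℝ f) (c : ℕ → ℝ) (K : ℝ) (hK : 0 ≤ K)
    (hc : ∀ l, |c l| ≤ K) (v : H) (s : Finset ℕ) :
    ‖∑ l ∈ s, (c l * ⟪f l, v⟫) • f l‖ ≤ K * ‖v‖ := by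
  have h1 : ‖∑ l ∈ s, (c l * ⟪f l, v⟫) • f l‖ ^ 2 = ∑ l ∈ s, (c l * ⟪f l, v⟫) ^ 2 := by
    rw [← real_inner_self_eq_norm_sq, hf.inner_sum]
    simp [sq]
  have h2 : ∑ l ∈ s, ‖⟪f l, v⟫‖ ^ 2 ≤ ‖v‖ ^ 2 := hf.sum_inner_products_le v
  refine abs_le_of_sq_le_sq' ?_ (by positivity) |>.2
  rw [h1, mul_pow]
  calc ∑ l ∈ s, (c l * ⟪f l, v⟫) ^ 2 ≤ ∑ l ∈ s, K ^ 2 * ‖⟪f l, v⟫‖ ^ 2 := by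
        refine Finset.sum_le_sum fun l _ => ?_
        rw [mul_pow, Real.norm_eq_abs, sq_abs]
        refine mul_le_mul_of_nonneg_right ?_ (sq_nonneg _)
        rw [← sq_abs]
        exact pow_le_pow_left₀ (abs_nonneg _) (hc l) 2
    _ = K ^ 2 * ∑ l ∈ s, ‖⟪f l, v⟫‖ ^ 2 := by rw [Finset.mul_sum]
    _ ≤ K ^ 2 * ‖v‖ ^ 2 := by gcongr

lemma aux_summable [CompleteSpace H] {f : ℕ → H} (hf : Orthonormal ℝ f) (c : ℕ → ℝ) (K : ℝ)
    (hc : ∀ l, |c l| ≤ K) (v : H) :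
    Summable fun l => (c l * ⟪f l, v⟫) • f l := by
  have h := (hf.orthogonalFamily.summable_iff_norm_sq_summable (fun l => c l * ⟪f l, v⟫)).2 (by
    refine Summable.of_nonneg_of_le (fun _ => by positivity) (fun l => ?_)
      ((hf.inner_products_summable v).mul_left (K ^ 2))
    rw [norm_mul, mul_pow]
    refine mul_le_mul_of_nonneg_right ?_ (by positivity)
    exact pow_le_pow_left₀ (abs_nonneg _) (hc l) 2)
  simpa using h

lemma aux_inner {f : ℕ → H} (hf : Orthonormal ℝ f) (c : ℕ → ℝ) (x : H)
    (h : HasSum (fun l => c l • f l) x) (k : ℕ) : ⟪f k, x⟫ = c k := by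
  have h1 := h.mapL (innerSL ℝ (f k))
  have h2 : HasSum (fun l => innerSL ℝ (f k) (c l • f l)) (c k) := by
    convert hasSum_ite_eq k (c k) using 2 with l
    rw [innerSL_apply_apply, inner_smul_right, orthonormal_iff_ite.1 hf]
    by_cases hlk : l = k
    · simp [hlk]
    · simp [hlk, Ne.symm hlk]
  exact h1.unique h2

end helpers

/-- Decomposition of the operator-valued Riccati equation: the operator family `Π_t`
built from the scalar Riccati solutions `Π̄^l` and `Π^⊥` satisfies the integral form of the
backward operator Riccati equation
`dP/dt = −(2A·I + 2bM)P + (2B²/R)P² − (Q/2)(I − ΓM)*(I − ΓM)`, `P_T = (Q_T/2)I`. -/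
theorem stmt13 {H : Type*} [NormedAddCommGroup H] [InnerProductSpace ℝ H] [CompleteSpace H]
    [TopologicalSpace.SeparableSpace H]
    (f : ℕ → H) (hf : Orthonormal ℝ f)
    (lam : ℕ → ℝ) (hlam : ∀ l, lam l ∈ Set.Icc (-1 : ℝ) 1)
    (T A b B Γ R Q QT : ℝ) (hT : 0 < T) (hR : 0 < R) (hQ : 0 ≤ Q) (hQT : 0 ≤ QT)
    (PiBar : ℕ → ℝ → ℝ) (PiBot : ℝ → ℝ)
    (hPiBar : ∀ l, ∀ t ∈ Set.Icc (0 : ℝ) T,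
      HasDerivWithinAt (PiBar l)
        (-((2 * A + 2 * b * lam l) * PiBar l t) + (2 * B ^ 2 / R) * (PiBar l t) ^ 2
          - (Q / 2) * (1 - Γ * lam l) ^ 2)
        (Set.Icc (0 : ℝ) T) t)
    (hPiBarT : ∀ l, PiBar l T = QT / 2)
    (hPiBot : ∀ t ∈ Set.Icc (0 : ℝ) T,
      HasDerivWithinAt PiBot
        (-(2 * A * PiBot t) + (2 * B ^ 2 / R) * (PiBot t) ^ 2 - Q / 2)
        (Set.Icc (0 : ℝ) T) t)
    (hPiBotT : PiBot T = QT / 2)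
    (hbd : ∃ C : ℝ, ∀ l, ∀ t ∈ Set.Icc (0 : ℝ) T, |PiBar l t| ≤ C) :
    ∀ t ∈ Set.Icc (0 : ℝ) T, ∀ v : H,
      PiFam f PiBar PiBot t v = (QT / 2) • v +
        ∫ s in t..T,
          ((2 * A) • PiFam f PiBar PiBot s v
            + (2 * b) • Mop f lam (PiFam f PiBar PiBot s v)
            - (2 * B ^ 2 / R) • PiFam f PiBar PiBot s (PiFam f PiBar PiBot s v)
            + (Q / 2) • (v - (2 * Γ) • Mop f lam v + Γ ^ 2 • Mop f lam (Mop f lam v))) := by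
  obtain ⟨C, hC⟩ := hbd
  set k : ℝ := 2 * B ^ 2 / R with hk
  have hbotc : ContinuousOn PiBot (Set.Icc 0 T) := fun t ht => (hPiBot t ht).continuousWithinAt
  have hbarc : ∀ l, ContinuousOn (PiBar l) (Set.Icc 0 T) :=
    fun l t ht => (hPiBar l t ht).continuousWithinAt
  obtain ⟨C0, hC0⟩ := isCompact_Icc.exists_bound_of_continuousOn hbotc
  -- the scalar right-hand sides
  set g : ℕ → ℝ → ℝ := fun l s => (2 * A + 2 * b * lam l) * PiBar l s - k * (PiBar l s) ^ 2
    + (Q / 2) * (1 - Γ * lam l) ^ 2 with hg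
  set g0 : ℝ → ℝ := fun s => 2 * A * PiBot s - k * (PiBot s) ^ 2 + Q / 2 with hg0
  have hgc : ∀ l, ContinuousOn (g l) (Set.Icc 0 T) := fun l => by
    have := hbarc l
    simp only [hg]; fun_prop
  have hg0c : ContinuousOn g0 (Set.Icc 0 T) := by simp only [hg0]; fun_prop
  obtain ⟨K1, hK1⟩ : ∃ K1, ∀ l, ∀ s ∈ Set.Icc (0 : ℝ) T, |g l s| ≤ K1 := by
    obtain ⟨K1, hK1⟩ := ((isCompact_Icc (a := (-1 : ℝ)) (b := 1)).prod
      (isCompact_Icc (a := -C) (b := C))).exists_bound_of_continuousOn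
      (f := fun x : ℝ × ℝ => (2 * A + 2 * b * x.1) * x.2 - k * x.2 ^ 2
        + (Q / 2) * (1 - Γ * x.1) ^ 2) (by fun_prop)
    exact ⟨K1, fun l s hs => hK1 (lam l, PiBar l s) ⟨hlam l, abs_le.1 (hC l s hs)⟩⟩
  obtain ⟨K0, hK0⟩ := isCompact_Icc.exists_bound_of_continuousOn hg0c
  have hlam1 : ∀ l, |lam l| ≤ 1 := fun l => abs_le.2 (hlam l)
  have hdiff : ∀ s ∈ Set.Icc (0 : ℝ) T, ∀ l, |g l s - g0 s| ≤ K1 + K0 := fun s hs l =>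
    (abs_sub _ _).trans (add_le_add (hK1 l s hs) (hK0 s hs))
  intro t ht v
  have hPi : ∀ s ∈ Set.Icc (0 : ℝ) T, ∀ w : H,
      HasSum (fun l => ((PiBar l s - PiBot s) * ⟪f l, w⟫) • f l)
        (PiFam f PiBar PiBot s w - PiBot s • w) := fun s hs w => by
    have := (aux_summable hf (fun l => PiBar l s - PiBot s) (C + C0) (fun l =>
      (abs_sub _ _).trans (add_le_add (hC l s hs) (hC0 s hs))) w).hasSum
    simpa [PiFam] using this
  have hM : ∀ w : H, HasSum (fun l => (lam l * ⟪f l, w⟫) • f l) (Mop f lam w) :=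
    fun w => (aux_summable hf lam 1 hlam1 w).hasSum
  have hMi : ∀ (w : H) l, ⟪f l, Mop f lam w⟫ = lam l * ⟪f l, w⟫ := fun w l =>
    aux_inner hf _ _ (hM w) l
  have hPii : ∀ s ∈ Set.Icc (0 : ℝ) T, ∀ (w : H) l,
      ⟪f l, PiFam f PiBar PiBot s w⟫ = PiBar l s * ⟪f l, w⟫ := fun s hs w l => by
    have := aux_inner hf _ _ (hPi s hs w) l
    rw [inner_sub_right, inner_smul_right] at this
    linarith
  set G : ℝ → H := fun s => ((2 * A) • PiFam f PiBar PiBot s v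
            + (2 * b) • Mop f lam (PiFam f PiBar PiBot s v)
            - k • PiFam f PiBar PiBot s (PiFam f PiBar PiBot s v)
            + (Q / 2) • (v - (2 * Γ) • Mop f lam v + Γ ^ 2 • Mop f lam (Mop f lam v))) with hG
  have hGsum : ∀ s ∈ Set.Icc (0 : ℝ) T,
      HasSum (fun l => ((g l s - g0 s) * ⟪f l, v⟫) • f l) (G s - g0 s • v) := fun s hs => by
    have e1 := hPi s hs v
    have e2 := hM (PiFam f PiBar PiBot s v)
    have e3 := hPi s hs (PiFam f PiBar PiBot s v)
    have e4 := hM v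
    have e5 := hM (Mop f lam v)
    simp only [hPii s hs, hMi] at e2 e3 e5
    have e := ((((e1.const_smul (2 * A)).add (e2.const_smul (2 * b))).sub
      ((e3.add (e1.const_smul (PiBot s))).const_smul k)).sub
      (e4.const_smul (Q / 2 * (2 * Γ)))).add (e5.const_smul (Q / 2 * Γ ^ 2))
    convert e using 1
    · funext l
      simp only [hg, hg0]
      module
    · simp only [hG, hg0]
      module
  -- the truncations
  set F : ℕ → ℝ → H := fun n s => g0 s • v
    + ∑ l ∈ Finset.range n, ((g l s - g0 s) * ⟪f l, v⟫) • f l with hF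
  set P : ℕ → ℝ → H := fun n s => PiBot s • v
    + ∑ l ∈ Finset.range n, ((PiBar l s - PiBot s) * ⟪f l, v⟫) • f l with hP
  have hFc : ∀ n, ContinuousOn (F n) (Set.Icc 0 T) := fun n => by
    simp only [hF]
    refine (hg0c.smul continuousOn_const).add (continuousOn_finsetSum _ fun l _ => ?_)
    exact (((hgc l).sub hg0c).mul continuousOn_const).smul continuousOn_const
  have hPd : ∀ n, ∀ s ∈ Set.Icc (0 : ℝ) T, HasDerivWithinAt (P n) (-F n s) (Set.Icc 0 T) s := by
    intro n s hs
    have h := ((hPiBot s hs).smul_const v).add (HasDerivWithinAt.fun_sum (u := Finset.range n)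
      fun l _ => ((((hPiBar l s hs).sub (hPiBot s hs)).mul_const ⟪f l, v⟫).smul_const (f l)))
    convert h using 1
    · rfl
    simp only [hF, neg_add, ← Finset.sum_neg_distrib]
    congr 1
    · simp only [hg0]; module
    · refine Finset.sum_congr rfl fun l _ => ?_
      simp only [hg, hg0]; module
  have hsub : Set.Icc t T ⊆ Set.Icc 0 T := Set.Icc_subset_Icc_left ht.1
  have hint : ∀ n, ∫ s in t..T, F n s = P n t - P n T := fun n => by
    have h := intervalIntegral.integral_eq_sub_of_hasDerivAt_of_le (f := P n)
      (f' := fun s => -F n s) ht.2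
      (fun s hs => ((hPd n s (hsub hs)).continuousWithinAt).mono hsub)
      (fun s hs => (hPd n s (hsub (Set.Ioo_subset_Icc_self hs))).hasDerivAt
        (Icc_mem_nhds (ht.1.trans_lt hs.1) hs.2))
      (ContinuousOn.intervalIntegrable_of_Icc ht.2 ((hFc n).mono hsub).neg)
    rw [intervalIntegral.integral_neg] at h
    rw [← neg_sub, ← h, neg_neg]
  have hPT : ∀ n, P n T = (QT / 2) • v := fun n => by
    simp [hP, hPiBarT, hPiBotT]
  have hlim1 : Filter.Tendsto (fun n => ∫ s in t..T, F n s) Filter.atTop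
      (nhds (PiFam f PiBar PiBot t v - (QT / 2) • v)) := by
    simp only [hint, hPT]
    refine Filter.Tendsto.sub_const ?_ _
    have := (hPi t ht v).tendsto_sum_nat.const_add (PiBot t • v)
    simpa [hP] using this
  have huIoc : ∀ s ∈ Set.uIoc t T, s ∈ Set.Icc (0 : ℝ) T := fun s hs => by
    rw [Set.uIoc_of_le ht.2] at hs
    exact hsub (Set.Ioc_subset_Icc_self hs)
  have hlim2 : Filter.Tendsto (fun n => ∫ s in t..T, F n s) Filter.atTop
      (nhds (∫ s in t..T, G s)) := by
    refine intervalIntegral.tendsto_integral_filter_of_dominated_convergence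
      (fun _ => K0 * ‖v‖ + (K1 + K0) * ‖v‖) ?_ ?_ ?_ ?_
    · refine Filter.Eventually.of_forall fun n => ?_
      exact ((hFc n).mono huIoc).aestronglyMeasurable measurableSet_uIoc
    · refine Filter.Eventually.of_forall fun n => Filter.Eventually.of_forall fun s hs => ?_
      have hs := huIoc s hs
      refine (norm_add_le _ _).trans (add_le_add ?_ ?_)
      · rw [norm_smul]
        exact mul_le_mul_of_nonneg_right (hK0 s hs) (norm_nonneg _)
      · exact aux_finite_bound hf (fun l => g l s - g0 s) _
          ((abs_nonneg _).trans (hdiff s hs 0)) (hdiff s hs) v _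
    · exact intervalIntegrable_const
    · refine Filter.Eventually.of_forall fun s hs => ?_
      have := (hGsum s (huIoc s hs)).tendsto_sum_nat.const_add (g0 s • v)
      simpa [hF] using this
  rw [← tendsto_nhds_unique hlim1 hlim2]
  abel
end
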